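/- Let b : Fin h → ℝ with b j ∈ {0, 1/2} for every j, and define θ̂(z) = θ(z + 2πi·b). Let M : Fin h → ℤ be such that M j is even for every index j with b j = 1/2. Then for every z : Fin h → ℂ, θ̂(z + Π.mulVec M) = Complex.exp (-(1/2) * (M ⬝ᵥ Π.mulVec M) - M ⬝ᵥ z) * θ̂(z); that is, θ̂ has exactly the same quasiperiodicity multiplier as θ under such shifts, with trivial extra factor exp(-2πi Mᵀb) = 1. (This is the key claim proved in Lemma 4 of the paper: the additional quasiperiodicity factor of the theta function with half-integer characteristic equals 1 when either the characteristic entry vanishes or the shift component is even.) -/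

import Mathlib

open Matrix Complex

/-- Entrywise coercion of an integer vector to a complex vector. -/
def intVecC {h : ℕ} (N : Fin h → ℤ) : Fin h → ℂ := fun i => (N i : ℂ)

/-- Entrywise coercion of a real vector to a complex vector. -/
def realVecC {h : ℕ} (b : Fin h → ℝ) : Fin h → ℂ := fun i => (b i : ℂ)

/-- The Prym theta function of the matrix `Pm`. -/
noncomputable def prymTheta {h : ℕ} (Pm : Matrix (Fin h) (Fin h) ℂ) (z : Fin h → ℂ) : ℂ :=
  ∑' N : Fin h → ℤ,
    Complex.exp ((1/2) * (intVecC N ⬝ᵥ Pm.mulVec (intVecC N)) + intVecC N ⬝ᵥ z)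

/-- `Pm` has negative definite real part: the real symmetric matrix of real parts
is negative definite, i.e. its negation is positive definite. -/
def HasNegDefRealPart {h : ℕ} (Pm : Matrix (Fin h) (Fin h) ℂ) : Prop :=
  (-(Matrix.of fun i j => (Pm i j).re)).PosDef

lemma intVecC_add {h : ℕ} (N M : Fin h → ℤ) : intVecC (N + M) = intVecC N + intVecC M := by
  ext i
  simp [intVecC]

/-- Quasiperiodicity of the theta function under shifts by the lattice `Pm ℤ^h`. -/
lemma prymTheta_add_mulVec {h : ℕ} {Pm : Matrix (Fin h) (Fin h) ℂ} (hsymm : Pm.IsSymm)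
    (M : Fin h → ℤ) (w : Fin h → ℂ) :
    prymTheta Pm (w + Pm.mulVec (intVecC M)) =
      Complex.exp (-(1/2) * (intVecC M ⬝ᵥ Pm.mulVec (intVecC M)) - intVecC M ⬝ᵥ w) *
        prymTheta Pm w := by
  unfold prymTheta
  rw [← tsum_mul_left, ← (Equiv.addRight M).tsum_eq (fun N : Fin h → ℤ => Complex.exp
    (-(1/2) * (intVecC M ⬝ᵥ Pm.mulVec (intVecC M)) - intVecC M ⬝ᵥ w) * _)]
  refine tsum_congr fun N => ?_
  have hcomm : intVecC M ⬝ᵥ Pm.mulVec (intVecC N) = intVecC N ⬝ᵥ Pm.mulVec (intVecC M) := by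
    rw [dotProduct_mulVec, ← mulVec_transpose, hsymm.eq, dotProduct_comm]
  rw [← Complex.exp_add, Equiv.coe_addRight, intVecC_add]
  congr 1
  simp only [mulVec_add, dotProduct_add, add_dotProduct, hcomm]
  ring

/-- The pairing of an integer vector with a half-integer characteristic is an integer if the
vector is even wherever the characteristic is nonzero. -/
lemma exists_int_eq_intVecC_dotProduct_realVecC {h : ℕ} {b : Fin h → ℝ}
    (hb : ∀ j, b j = 0 ∨ b j = 1/2) {M : Fin h → ℤ} (hM : ∀ j, b j = 1/2 → Even (M j)) :
    ∃ k : ℤ, intVecC M ⬝ᵥ realVecC b = k := by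
  have hterm : ∀ j, ∃ k : ℤ, intVecC M j * realVecC b j = k := by
    intro j
    rcases hb j with hj | hj
    · exact ⟨0, by simp [realVecC, hj]⟩
    · obtain ⟨k, hk⟩ := hM j hj
      refine ⟨k, ?_⟩
      simp only [intVecC, realVecC, hj, hk]
      push_cast
      ring
  choose k hk using hterm
  exact ⟨∑ j, k j, by simp [dotProduct, hk]⟩

/-- for a half-integer characteristic `b` with entries in `{0, 1/2}`,
and a shift vector `M` which is even at every index where `b` equals `1/2`,
the theta function with characteristic `b` has exactly the same quasiperiodicity
multiplier as `θ`. -/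
theorem prymThetaChar_quasiperiodic_trivial_factor {h : ℕ}
    (Pm : Matrix (Fin h) (Fin h) ℂ)
    (hsymm : Pm.IsSymm) (hneg : HasNegDefRealPart Pm) (b : Fin h → ℝ)
    (hb : ∀ j, b j = 0 ∨ b j = 1/2)
    (M : Fin h → ℤ) (hM : ∀ j, b j = 1/2 → Even (M j)) (z : Fin h → ℂ) :
    prymTheta Pm (z + Pm.mulVec (intVecC M) + (2 * Real.pi * Complex.I) • realVecC b) =
      Complex.exp (-(1/2) * (intVecC M ⬝ᵥ Pm.mulVec (intVecC M)) - intVecC M ⬝ᵥ z) *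
        prymTheta Pm (z + (2 * Real.pi * Complex.I) • realVecC b) := by
  obtain ⟨k, hk⟩ := exists_int_eq_intVecC_dotProduct_realVecC hb hM
  rw [add_right_comm, prymTheta_add_mulVec hsymm, dotProduct_add, dotProduct_smul, hk,
    smul_eq_mul, ← sub_sub, mul_comm _ (k : ℂ), Complex.exp_sub _ ((k : ℂ) * _),
    Complex.exp_int_mul_two_pi_mul_I, div_one]
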